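/- Let (𝒜, ℬ, 𝒞) be a recollement of abelian categories, and let 𝒵' and 𝒵'' be support τ-tilting subcategories of 𝒜 and 𝒞, respectively. If i^* and i^! are exact, then 𝒵 = {Z ∈ ℬ | i^*(Z) ∈ 𝒵', i^!(Z) ∈ 𝒵', and j^*(Z) ∈ 𝒵''} is a support τ-tilting subcategory of ℬ. -/

import Mathlib

open CategoryTheory Limits Abelian

universe w₁ w₂ w₃ v₁ v₂ v₃ u₁ u₂ u₃

/-- A recollement of abelian categories. Exactness conditions on the six functors
(`i_*`, `j^*` exact; `i^*`, `j_!` right exact; `i^!`, `j_*` left exact) are automatic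
from the adjunctions. -/
structure Recollement (𝒜 : Type u₁) (ℬ : Type u₂) (𝒞 : Type u₃)
    [Category.{v₁} 𝒜] [Category.{v₂} ℬ] [Category.{v₃} 𝒞]
    [Abelian 𝒜] [Abelian ℬ] [Abelian 𝒞] where
  /-- `i_* : 𝒜 ⥤ ℬ` -/
  iStar : 𝒜 ⥤ ℬ
  /-- `i^* : ℬ ⥤ 𝒜` -/
  iUS : ℬ ⥤ 𝒜
  /-- `i^! : ℬ ⥤ 𝒜` -/
  iUE : ℬ ⥤ 𝒜
  /-- `j^* : ℬ ⥤ 𝒞` -/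
  jUS : ℬ ⥤ 𝒞
  /-- `j_! : 𝒞 ⥤ ℬ` -/
  jLE : 𝒞 ⥤ ℬ
  /-- `j_* : 𝒞 ⥤ ℬ` -/
  jLS : 𝒞 ⥤ ℬ
  /-- the adjunction `(i^*, i_*)` -/
  adj₁ : iUS ⊣ iStar
  /-- the adjunction `(i_*, i^!)` -/
  adj₂ : iStar ⊣ iUE
  /-- the adjunction `(j_!, j^*)` -/
  adj₃ : jLE ⊣ jUS
  /-- the adjunction `(j^*, j_*)` -/
  adj₄ : jUS ⊣ jLS
  iStar_full : iStar.Full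
  iStar_faithful : iStar.Faithful
  jLE_full : jLE.Full
  jLE_faithful : jLE.Faithful
  jLS_full : jLS.Full
  jLS_faithful : jLS.Faithful
  /-- `Im i_* = Ker j^*` -/
  essImage_iStar : ∀ X : ℬ, iStar.essImage X ↔ IsZero (jUS.obj X)

variable {𝒟 : Type u₁} [Category.{v₁} 𝒟] [Abelian 𝒟]

/-- a subcategory (given by a set of objects) closed under isomorphisms and (finite) direct
sums. -/
def IsGoodSubcat (S : Set 𝒟) : Prop :=
  (∀ ⦃X Y : 𝒟⦄, (X ≅ Y) → X ∈ S → Y ∈ S) ∧ ∀ X Y : 𝒟, X ∈ S → Y ∈ S → (X ⊞ Y) ∈ S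

/-- exactness at `Y` of `X ⟶ Y ⟶ Z`. -/
def ExactAt {X Y Z : 𝒟} (f : X ⟶ Y) (g : Y ⟶ Z) : Prop :=
  ∃ w : f ≫ g = 0, (ShortComplex.mk f g w).Exact

section Ext
variable [HasExt.{w₁} 𝒟]

/-- `⊥S`: objects `M` with `Ext^i(M, N) = 0` for all `i ≥ 1`, `N ∈ S`. -/
def leftPerp (S : Set 𝒟) : Set 𝒟 :=
  {M | ∀ N ∈ S, ∀ i : ℕ, 1 ≤ i → Subsingleton (Ext M N i)}

/-- a self-orthogonal subcategory. -/
def SelfOrthogonal (S : Set 𝒟) : Prop :=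
  ∀ M ∈ S, ∀ N ∈ S, ∀ i : ℕ, 1 ≤ i → Subsingleton (Ext M N i)

/-- The subcategory `X_S` : objects `M ∈ ⊥S` admitting an exact sequence
`0 ⟶ M ⟶ W 0 ⟶ W 1 ⟶ ⋯` with all `W i ∈ S` and images of differentials in `⊥S`. -/
def wakClass (S : Set 𝒟) : Set 𝒟 :=
  {M | M ∈ leftPerp S ∧ ∃ (W : ℕ → 𝒟) (f : M ⟶ W 0) (d : ∀ n, W n ⟶ W (n + 1)),
    (∀ n, W n ∈ S) ∧ Mono f ∧ ExactAt f (d 0) ∧ (∀ n, ExactAt (d n) (d (n + 1))) ∧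
    (∀ n, image (d n) ∈ leftPerp S)}

/-- a wakamatsu tilting subcategory. -/
def WakamatsuTilting (S : Set 𝒟) : Prop :=
  SelfOrthogonal S ∧ ∀ P : 𝒟, Projective P → P ∈ wakClass S

end Ext

/-- `Fac S`. -/
def Fac (S : Set 𝒟) : Set 𝒟 :=
  {X | ∃ M ∈ S, ∃ f : M ⟶ X, Epi f}

/-- `f : A ⟶ M` is a left `S`-approximation of `A`. -/
def IsLeftApprox (S : Set 𝒟) {A M : 𝒟} (f : A ⟶ M) : Prop :=
  M ∈ S ∧ ∀ M' ∈ S, ∀ g : A ⟶ M', ∃ h : M ⟶ M', f ≫ h = g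

/-- `f : M ⟶ A` is a right `S`-approximation of `A`. -/
def IsRightApprox (S : Set 𝒟) {M A : 𝒟} (f : M ⟶ A) : Prop :=
  M ∈ S ∧ ∀ M' ∈ S, ∀ g : M' ⟶ A, ∃ h : M' ⟶ M, h ≫ f = g

/-- a contravariantly finite subcategory. -/
def ContravariantlyFinite (S : Set 𝒟) : Prop :=
  ∀ A : 𝒟, ∃ (M : 𝒟) (f : M ⟶ A), IsRightApprox S f

section Ext
variable [HasExt.{w₁} 𝒟]

/-- a weak support τ-tilting subcategory. -/
def WeakSupportTauTilting (S : Set 𝒟) : Prop :=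
  (∀ M ∈ S, ∀ L ∈ Fac S, Subsingleton (Ext M L 1)) ∧
  ∀ P : 𝒟, Projective P → ∃ (M₀ M₁ : 𝒟) (f : P ⟶ M₀) (g : M₀ ⟶ M₁),
    M₀ ∈ S ∧ M₁ ∈ S ∧ Epi g ∧ ExactAt f g ∧ IsLeftApprox S f

/-- a support τ-tilting subcategory. -/
def SupportTauTilting (S : Set 𝒟) : Prop :=
  WeakSupportTauTilting S ∧ ContravariantlyFinite S

/-- `^⊥₁ S`. -/
def perpOneLeft (S : Set 𝒟) : Set 𝒟 :=
  {A | ∀ M ∈ S, Subsingleton (Ext A M 1)}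

end Ext

/-- `S^⊥₀`. -/
def perpZeroRight (S : Set 𝒟) : Set 𝒟 :=
  {A | ∀ M ∈ S, ∀ f : M ⟶ A, f = 0}

/-- a torsion pair. -/
def TorsionPair (T F : Set 𝒟) : Prop :=
  (∀ X ∈ T, ∀ Y ∈ F, ∀ f : X ⟶ Y, f = 0) ∧
  ∀ B : 𝒟, ∃ (X Y : 𝒟) (f : X ⟶ B) (g : B ⟶ Y),
    X ∈ T ∧ Y ∈ F ∧ Mono f ∧ Epi g ∧ ExactAt f g

/-- a τ-cotorsion torsion triple. -/
def TauCotorsionTorsionTriple [HasExt.{w₁} 𝒟] (L D F : Set 𝒟) : Prop :=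
  L = perpOneLeft D ∧
  (∀ P : 𝒟, Projective P → ∃ (D₀ C₀ : 𝒟) (f : P ⟶ D₀) (g : D₀ ⟶ C₀),
    D₀ ∈ L ∩ D ∧ C₀ ∈ L ∧ Epi g ∧ ExactAt f g ∧ IsLeftApprox D f) ∧
  ContravariantlyFinite (L ∩ D) ∧ TorsionPair D F

/-- the closure under isomorphism of the image of a subcategory under a functor. -/
def imgCl {𝒟' : Type u₂} [Category.{v₂} 𝒟'] (F : 𝒟 ⥤ 𝒟') (S : Set 𝒟) : Set 𝒟' :=
  {X | ∃ Y ∈ S, Nonempty (F.obj Y ≅ X)}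

/-- `ℬ` looks like the product of `𝒜` and `𝒞` through `F` and `G`. -/
structure ProdLike {𝒜 : Type u₁} {ℬ : Type u₂} {𝒞 : Type u₃}
    [Category.{v₁} 𝒜] [Category.{v₂} ℬ] [Category.{v₃} 𝒞]
    (F : ℬ ⥤ 𝒜) (G : ℬ ⥤ 𝒞) : Prop where
  full : ∀ (X Y : ℬ) (a : F.obj X ⟶ F.obj Y) (c : G.obj X ⟶ G.obj Y),
    ∃ f : X ⟶ Y, F.map f = a ∧ G.map f = c
  faith : ∀ (X Y : ℬ) (f g : X ⟶ Y), F.map f = F.map g → G.map f = G.map g → f = g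
  ess : ∀ (A : 𝒜) (C : 𝒞), ∃ X : ℬ, Nonempty (F.obj X ≅ A) ∧ Nonempty (G.obj X ≅ C)

section ProdLike

variable {𝒜 : Type u₁} {ℬ : Type u₂} {𝒞 : Type u₃}
    [Category.{v₁} 𝒜] [Category.{v₂} ℬ] [Category.{v₃} 𝒞]

theorem ProdLike.swap {F : ℬ ⥤ 𝒜} {G : ℬ ⥤ 𝒞} (h : ProdLike F G) : ProdLike G F where
  full X Y a c := by
    obtain ⟨f, h1, h2⟩ := h.full X Y c a
    exact ⟨f, h2, h1⟩
  faith X Y f g h1 h2 := h.faith X Y f g h2 h1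
  ess A C := by
    obtain ⟨X, h1, h2⟩ := h.ess C A
    exact ⟨X, h2, h1⟩

theorem ProdLike.epi {F : ℬ ⥤ 𝒜} {G : ℬ ⥤ 𝒞} (h : ProdLike F G) {X Y : ℬ} (f : X ⟶ Y)
    (h1 : Epi (F.map f)) (h2 : Epi (G.map f)) : Epi f where
  left_cancellation a b hab := by
    apply h.faith
    · rw [← cancel_epi (F.map f), ← F.map_comp, ← F.map_comp, hab]
    · rw [← cancel_epi (G.map f), ← G.map_comp, ← G.map_comp, hab]

variable [Abelian 𝒜] [Abelian ℬ] [Abelian 𝒞]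

open ZeroObject in
theorem ProdLike.projective {F : ℬ ⥤ 𝒜} {G : ℬ ⥤ 𝒞} (h : ProdLike F G) (P : ℬ)
    (hP : Projective P) : Projective (F.obj P) where
  factors {E X} g e he := by
    obtain ⟨E', ⟨eE⟩, ⟨zE⟩⟩ := h.ess E (0 : 𝒞)
    obtain ⟨X', ⟨eX⟩, ⟨zX⟩⟩ := h.ess X (0 : 𝒞)
    have hzX : IsZero (G.obj X') := (isZero_zero 𝒞).of_iso zX
    obtain ⟨e', he1, -⟩ := h.full E' X' (eE.hom ≫ e ≫ eX.inv) 0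
    obtain ⟨g', hg1, -⟩ := h.full P X' (g ≫ eX.inv) 0
    have : Epi e' := h.epi e' (by rw [he1]; infer_instance) ⟨fun a b _ => hzX.eq_of_src _ _⟩
    refine ⟨F.map (Projective.factorThru g' e') ≫ eE.hom, ?_⟩
    rw [← cancel_mono eX.inv, ← hg1]
    conv_rhs => rw [← Projective.factorThru_comp g' e', F.map_comp, he1]
    simp

theorem ProdLike.exact {F : ℬ ⥤ 𝒜} {G : ℬ ⥤ 𝒞} (h : ProdLike F G)
    [PreservesFiniteLimits F] [PreservesFiniteColimits F]
    [PreservesFiniteLimits G] [PreservesFiniteColimits G]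
    {X Y Z : ℬ} (f : X ⟶ Y) (g : Y ⟶ Z)
    (h1 : ExactAt (F.map f) (F.map g)) (h2 : ExactAt (G.map f) (G.map g)) : ExactAt f g := by
  obtain ⟨w1, h1⟩ := h1
  obtain ⟨w2, h2⟩ := h2
  have w : f ≫ g = 0 := h.faith _ _ _ _ (by simpa using w1) (by simpa using w2)
  refine ⟨w, ?_⟩
  have k1 : IsZero (F.obj (ShortComplex.mk f g w).homology) := by
    refine IsZero.of_iso ?_ ((ShortComplex.mk f g w).mapHomologyIso F).symm
    exact (ShortComplex.exact_iff_isZero_homology _).1 h1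
  have k2 : IsZero (G.obj (ShortComplex.mk f g w).homology) := by
    refine IsZero.of_iso ?_ ((ShortComplex.mk f g w).mapHomologyIso G).symm
    exact (ShortComplex.exact_iff_isZero_homology _).1 h2
  rw [ShortComplex.exact_iff_isZero_homology, IsZero.iff_id_eq_zero]
  exact h.faith _ _ _ _ (k1.eq_of_src _ _) (k2.eq_of_src _ _)

theorem exactAt_iso {X Y Z Y' Z' : 𝒜} {f : X ⟶ Y} {g : Y ⟶ Z} (h : ExactAt f g)
    (e : Y' ≅ Y) (e' : Z' ≅ Z) : ExactAt (f ≫ e.inv) (e.hom ≫ g ≫ e'.inv) := by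
  obtain ⟨w, h⟩ := h
  refine ⟨by simp [reassoc_of% w], ?_⟩
  refine (ShortComplex.exact_iff_of_iso ?_).1 h
  exact ShortComplex.isoMk (Iso.refl _) e.symm e'.symm (by simp) (by simp)

theorem ext_lift [HasExt.{w₁} 𝒜] {S : ShortComplex 𝒜} (hS : S.ShortExact) (L : 𝒜)
    (h : Subsingleton (Ext.{w₁} S.X₃ L 1)) (k : S.X₁ ⟶ L) : ∃ p : S.X₂ ⟶ L, S.f ≫ p = k := by
  obtain ⟨x, hx⟩ := Ext.contravariant_sequence_exact₁ hS L (Ext.mk₀ k) (n₁ := 1) rfl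
    (Subsingleton.elim _ _)
  obtain ⟨p, rfl⟩ := (Ext.mk₀_bijective _ _).2 x
  refine ⟨p, (Ext.mk₀_bijective _ _).1 ?_⟩
  rw [← hx, Ext.mk₀_comp_mk₀]

theorem ProdLike.ext [EnoughProjectives ℬ]
    [HasExt.{w₁} 𝒜] [HasExt.{w₂} ℬ] [HasExt.{w₃} 𝒞]
    {F : ℬ ⥤ 𝒜} {G : ℬ ⥤ 𝒞} (h : ProdLike F G)
    [PreservesFiniteLimits F] [PreservesFiniteColimits F]
    [PreservesFiniteLimits G] [PreservesFiniteColimits G]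
    (M L : ℬ) (h1 : Subsingleton (Ext.{w₁} (F.obj M) (F.obj L) 1))
    (h2 : Subsingleton (Ext.{w₃} (G.obj M) (G.obj L) 1)) : Subsingleton (Ext.{w₂} M L 1) := by
  let S : ShortComplex ℬ := ShortComplex.mk _ _ (kernel.condition (Projective.π M))
  have hS : S.ShortExact :=
    { exact := ShortComplex.exact_of_f_is_kernel _ (kernelIsKernel _)
      mono_f := by dsimp [S]; infer_instance
      epi_g := by dsimp [S]; infer_instance }
  have := F.additive_of_preserves_binary_products
  have := G.additive_of_preserves_binary_products
  have hF : (S.map F).ShortExact := hS.map_of_exact F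
  have hG : (S.map G).ShortExact := hS.map_of_exact G
  refine subsingleton_of_forall_eq 0 fun x => ?_
  obtain ⟨y, rfl⟩ := Ext.contravariant_sequence_exact₃ hS L x
    (Ext.eq_zero_of_projective (P := Projective.over M) _) (n₀ := 0) rfl
  obtain ⟨k, rfl⟩ := (Ext.mk₀_bijective _ _).2 y
  obtain ⟨p1, hp1⟩ := ext_lift hF (F.obj L) h1 (F.map k)
  obtain ⟨p2, hp2⟩ := ext_lift hG (G.obj L) h2 (G.map k)
  obtain ⟨p, rfl, rfl⟩ := h.full _ _ p1 p2
  have : k = S.f ≫ p := h.faith _ _ _ _ (by rw [F.map_comp]; exact hp1.symm)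
    (by rw [G.map_comp]; exact hp2.symm)
  rw [this, ← Ext.mk₀_comp_mk₀, ← Ext.comp_assoc _ _ _ (rfl : 1 + 0 = 1) (rfl : 0 + 0 = 0) rfl]
  simp

theorem ProdLike.supportTauTilting [EnoughProjectives ℬ]
    [HasExt.{w₁} 𝒜] [HasExt.{w₂} ℬ] [HasExt.{w₃} 𝒞]
    {F : ℬ ⥤ 𝒜} {G : ℬ ⥤ 𝒞} (h : ProdLike F G)
    [PreservesFiniteLimits F] [PreservesFiniteColimits F]
    [PreservesFiniteLimits G] [PreservesFiniteColimits G]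
    (𝒵' : Set 𝒜) (𝒵'' : Set 𝒞)
    (good' : IsGoodSubcat 𝒵') (good'' : IsGoodSubcat 𝒵'')
    (h' : SupportTauTilting.{w₁} 𝒵') (h'' : SupportTauTilting.{w₃} 𝒵'') :
    SupportTauTilting.{w₂} {Z : ℬ | F.obj Z ∈ 𝒵' ∧ G.obj Z ∈ 𝒵''} := by
  refine ⟨⟨?_, ?_⟩, ?_⟩
  · rintro M ⟨hM1, hM2⟩ L ⟨N, ⟨hN1, hN2⟩, q, hq⟩
    exact h.ext M L (h'.1.1 _ hM1 _ ⟨_, hN1, F.map q, inferInstance⟩)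
      (h''.1.1 _ hM2 _ ⟨_, hN2, G.map q, inferInstance⟩)
  · intro P hP
    obtain ⟨A₀, A₁, f', g', hA₀, hA₁, eg', ex', ap'⟩ := h'.1.2 _ (h.projective P hP)
    obtain ⟨C₀, C₁, f'', g'', hC₀, hC₁, eg'', ex'', ap''⟩ := h''.1.2 _ (h.swap.projective P hP)
    obtain ⟨M₀, ⟨a₀⟩, ⟨c₀⟩⟩ := h.ess A₀ C₀
    obtain ⟨M₁, ⟨a₁⟩, ⟨c₁⟩⟩ := h.ess A₁ C₁
    obtain ⟨f, hf1, hf2⟩ := h.full P M₀ (f' ≫ a₀.inv) (f'' ≫ c₀.inv)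
    obtain ⟨g, hg1, hg2⟩ := h.full M₀ M₁ (a₀.hom ≫ g' ≫ a₁.inv) (c₀.hom ≫ g'' ≫ c₁.inv)
    have m₀ : F.obj M₀ ∈ 𝒵' ∧ G.obj M₀ ∈ 𝒵'' := ⟨good'.1 a₀.symm hA₀, good''.1 c₀.symm hC₀⟩
    refine ⟨M₀, M₁, f, g, m₀, ⟨good'.1 a₁.symm hA₁, good''.1 c₁.symm hC₁⟩, ?_, ?_, m₀, ?_⟩
    · exact h.epi g (by rw [hg1]; infer_instance) (by rw [hg2]; infer_instance)
    · apply h.exact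
      · rw [hf1, hg1]; exact exactAt_iso ex' a₀ a₁
      · rw [hf2, hg2]; exact exactAt_iso ex'' c₀ c₁
    · rintro M' ⟨k1, k2⟩ q
      obtain ⟨x, hx⟩ := ap'.2 _ k1 (F.map q)
      obtain ⟨y, hy⟩ := ap''.2 _ k2 (G.map q)
      obtain ⟨r, hr1, hr2⟩ := h.full M₀ M' (a₀.hom ≫ x) (c₀.hom ≫ y)
      exact ⟨r, h.faith _ _ _ _ (by simp [hf1, hr1, hx]) (by simp [hf2, hr2, hy])⟩
  · intro B
    obtain ⟨A, f', hA, ap'⟩ := h'.2 (F.obj B)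
    obtain ⟨C, f'', hC, ap''⟩ := h''.2 (G.obj B)
    obtain ⟨M, ⟨a⟩, ⟨c⟩⟩ := h.ess A C
    obtain ⟨f, hf1, hf2⟩ := h.full M B (a.hom ≫ f') (c.hom ≫ f'')
    refine ⟨M, f, ⟨good'.1 a.symm hA, good''.1 c.symm hC⟩, ?_⟩
    rintro M' ⟨k1, k2⟩ q
    obtain ⟨x, hx⟩ := ap' _ k1 (F.map q)
    obtain ⟨y, hy⟩ := ap'' _ k2 (G.map q)
    obtain ⟨r, hr1, hr2⟩ := h.full M' M (x ≫ a.inv) (y ≫ c.inv)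
    exact ⟨r, h.faith _ _ _ _ (by simp [hf1, hr1, hx]) (by simp [hf2, hr2, hy])⟩

end ProdLike

theorem isIso_map_fst {𝒳 : Type u₁} {𝒴 : Type u₂} [Category.{v₁} 𝒳] [Category.{v₂} 𝒴]
    [Abelian 𝒳] [Abelian 𝒴] (F : 𝒳 ⥤ 𝒴) [F.Additive] (X Y : 𝒳) (h : IsZero (F.obj Y)) :
    IsIso (F.map (biprod.fst : X ⊞ Y ⟶ X)) := by
  refine ⟨F.map biprod.inl, ?_, by rw [← F.map_comp, biprod.inl_fst, F.map_id]⟩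
  rw [← F.map_comp, ← F.map_id, ← biprod.total, F.map_add]
  have : F.map ((biprod.snd : X ⊞ Y ⟶ Y) ≫ (biprod.inr : Y ⟶ X ⊞ Y)) = 0 := by
    rw [F.map_comp, h.eq_of_tgt (F.map biprod.snd) 0, zero_comp]
  rw [this, add_zero]

theorem isIso_map_snd {𝒳 : Type u₁} {𝒴 : Type u₂} [Category.{v₁} 𝒳] [Category.{v₂} 𝒴]
    [Abelian 𝒳] [Abelian 𝒴] (F : 𝒳 ⥤ 𝒴) [F.Additive] (X Y : 𝒳) (h : IsZero (F.obj X)) :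
    IsIso (F.map (biprod.snd : X ⊞ Y ⟶ Y)) := by
  refine ⟨F.map biprod.inr, ?_, by rw [← F.map_comp, biprod.inr_snd, F.map_id]⟩
  rw [← F.map_comp, ← F.map_id, ← biprod.total, F.map_add]
  have : F.map ((biprod.fst : X ⊞ Y ⟶ X) ≫ (biprod.inl : X ⟶ X ⊞ Y)) = 0 := by
    rw [F.map_comp, h.eq_of_tgt (F.map biprod.fst) 0, zero_comp]
  rw [this, zero_add]

section Recoll

variable {𝒜 : Type u₁} {ℬ : Type u₂} {𝒞 : Type u₃}
    [Category.{v₁} 𝒜] [Category.{v₂} ℬ] [Category.{v₃} 𝒞]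
    [Abelian 𝒜] [Abelian ℬ] [Abelian 𝒞]

namespace Recollement

variable (R : Recollement 𝒜 ℬ 𝒞)

theorem jUS_lims : PreservesFiniteLimits R.jUS :=
  have := R.adj₃.rightAdjoint_preservesLimits
  ⟨fun _ _ _ => inferInstance⟩

theorem jUS_colims : PreservesFiniteColimits R.jUS :=
  have := R.adj₄.leftAdjoint_preservesColimits
  ⟨fun _ _ _ => inferInstance⟩

theorem jUS_iStar (A : 𝒜) : IsZero (R.jUS.obj (R.iStar.obj A)) :=
  (R.essImage_iStar _).1 (R.iStar.obj_mem_essImage A)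

/-- `i^* i_* = id` -/
noncomputable def isoA (A : 𝒜) : R.iUS.obj (R.iStar.obj A) ≅ A :=
  have := R.iStar_full
  have := R.iStar_faithful
  (asIso R.adj₁.counit).app A

/-- `i^! i_* = id` -/
noncomputable def isoA' (A : 𝒜) : R.iUE.obj (R.iStar.obj A) ≅ A :=
  have := R.iStar_full
  have := R.iStar_faithful
  ((asIso R.adj₂.unit).app A).symm

/-- `j^* j_* = id` -/
noncomputable def isoC (C : 𝒞) : R.jUS.obj (R.jLS.obj C) ≅ C :=
  have := R.jLS_full
  have := R.jLS_faithful
  (asIso R.adj₄.counit).app C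

theorem iUE_jLS (C : 𝒞) : IsZero (R.iUE.obj (R.jLS.obj C)) := by
  rw [IsZero.iff_id_eq_zero]
  apply (R.adj₂.homEquiv _ _).symm.injective
  apply (R.adj₄.homEquiv _ _).symm.injective
  exact (R.jUS_iStar _).eq_of_src _ _

theorem isZero_of (X : ℬ) (h1 : IsZero (R.iUS.obj X)) (h2 : IsZero (R.jUS.obj X)) : IsZero X := by
  obtain ⟨A, ⟨e⟩⟩ := (R.essImage_iStar X).2 h2
  have hA : IsZero A := (h1.of_iso (R.iUS.mapIso e)).of_iso (R.isoA A).symm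
  have := R.adj₂.leftAdjoint_preservesColimits
  have : PreservesFiniteColimits R.iStar := ⟨fun _ _ _ => inferInstance⟩
  exact (R.iStar.map_isZero hA).of_iso e.symm

theorem isIso_iUS_unit (B : ℬ) : IsIso (R.iUS.map (R.adj₁.unit.app B)) := by
  have := R.iStar_full
  have := R.iStar_faithful
  infer_instance

theorem isIso_jUS_unit (B : ℬ) : IsIso (R.jUS.map (R.adj₄.unit.app B)) := by
  have := R.jLS_full
  have := R.jLS_faithful
  infer_instance

variable [PreservesFiniteLimits R.iUS] [PreservesFiniteColimits R.iUS]

theorem epi_of {X Y : ℬ} (f : X ⟶ Y) (h1 : Epi (R.iUS.map f)) (h2 : Epi (R.jUS.map f)) :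
    Epi f := by
  have := R.jUS_lims
  have := R.jUS_colims
  apply Preadditive.epi_of_isZero_cokernel
  apply R.isZero_of
  · exact (isZero_cokernel_of_epi _).of_iso (PreservesCokernel.iso R.iUS f)
  · exact (isZero_cokernel_of_epi _).of_iso (PreservesCokernel.iso R.jUS f)

theorem mono_of {X Y : ℬ} (f : X ⟶ Y) (h1 : Mono (R.iUS.map f)) (h2 : Mono (R.jUS.map f)) :
    Mono f := by
  have := R.jUS_lims
  have := R.jUS_colims
  apply Preadditive.mono_of_isZero_kernel
  apply R.isZero_of
  · exact (isZero_kernel_of_mono _).of_iso (PreservesKernel.iso R.iUS f)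
  · exact (isZero_kernel_of_mono _).of_iso (PreservesKernel.iso R.jUS f)

theorem epi_unit (B : ℬ) : Epi (R.adj₁.unit.app B) :=
  have := R.isIso_iUS_unit B
  R.epi_of _ inferInstance ⟨fun _ _ _ => (R.jUS_iStar _).eq_of_src _ _⟩

variable [PreservesFiniteLimits R.iUE] [PreservesFiniteColimits R.iUE]

theorem iUS_jLS (C : 𝒞) : IsZero (R.iUS.obj (R.jLS.obj C)) := by
  have := R.epi_unit (R.jLS.obj C)
  have h : Epi (R.iUE.map (R.adj₁.unit.app (R.jLS.obj C))) := inferInstance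
  have := IsZero.of_epi (R.iUE.map (R.adj₁.unit.app (R.jLS.obj C))) (R.iUE_jLS C)
  exact this.of_iso (R.isoA' _).symm

/-- the decomposition map -/
noncomputable def dec (B : ℬ) :
    B ⟶ R.iStar.obj (R.iUS.obj B) ⊞ R.jLS.obj (R.jUS.obj B) :=
  biprod.lift (R.adj₁.unit.app B) (R.adj₄.unit.app B)

theorem isIso_dec (B : ℬ) : IsIso (R.dec B) := by
  have := R.jUS_lims
  have := R.jUS_colims
  have := R.iUS.additive_of_preserves_binary_products
  have := R.jUS.additive_of_preserves_binary_products
  have h1 : IsIso (R.iUS.map (R.dec B)) := by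
    have a := isIso_map_fst R.iUS (R.iStar.obj (R.iUS.obj B)) (R.jLS.obj (R.jUS.obj B))
      (R.iUS_jLS _)
    have b : IsIso (R.iUS.map (R.dec B) ≫ R.iUS.map biprod.fst) := by
      rw [← Functor.map_comp, dec, biprod.lift_fst]
      exact R.isIso_iUS_unit B
    exact IsIso.of_isIso_comp_right _ (R.iUS.map biprod.fst)
  have h2 : IsIso (R.jUS.map (R.dec B)) := by
    have a := isIso_map_snd R.jUS (R.iStar.obj (R.iUS.obj B)) (R.jLS.obj (R.jUS.obj B))
      (R.jUS_iStar _)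
    have b : IsIso (R.jUS.map (R.dec B) ≫ R.jUS.map biprod.snd) := by
      rw [← Functor.map_comp, dec, biprod.lift_snd]
      exact R.isIso_jUS_unit B
    exact IsIso.of_isIso_comp_right _ (R.jUS.map biprod.snd)
  have := R.mono_of (R.dec B) inferInstance inferInstance
  have := R.epi_of (R.dec B) inferInstance inferInstance
  exact isIso_of_mono_of_epi _

theorem prodLike : ProdLike R.iUS R.jUS where
  full X Y a c := by
    have := R.isIso_dec Y
    let f : X ⟶ Y := biprod.lift (R.adj₁.unit.app X ≫ R.iStar.map a)
      (R.adj₄.unit.app X ≫ R.jLS.map c) ≫ inv (R.dec Y)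
    have hf : f ≫ R.dec Y = biprod.lift (R.adj₁.unit.app X ≫ R.iStar.map a)
      (R.adj₄.unit.app X ≫ R.jLS.map c) := by simp [f]
    refine ⟨f, ?_, ?_⟩
    · apply (R.adj₁.homEquiv _ _).injective
      have := congrArg (· ≫ biprod.fst) hf
      simp only [dec, Category.assoc, biprod.lift_fst] at this
      rw [Adjunction.homEquiv_unit, Adjunction.homEquiv_unit, ← this]
      exact (R.adj₁.unit.naturality f).symm
    · apply (R.adj₄.homEquiv _ _).injective
      have := congrArg (· ≫ biprod.snd) hf
      simp only [dec, Category.assoc, biprod.lift_snd] at this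
      rw [Adjunction.homEquiv_unit, Adjunction.homEquiv_unit, ← this]
      exact (R.adj₄.unit.naturality f).symm
  faith X Y f g h1 h2 := by
    have := R.isIso_dec Y
    rw [← cancel_mono (R.dec Y)]
    apply biprod.hom_ext
    · simp only [dec, Category.assoc, biprod.lift_fst]
      have e1 := R.adj₁.unit.naturality f
      have e2 := R.adj₁.unit.naturality g
      simp only [Functor.id_map, Functor.comp_map] at e1 e2
      exact e1.trans (by rw [h1]; exact e2.symm)
    · simp only [dec, Category.assoc, biprod.lift_snd]
      have e1 := R.adj₄.unit.naturality f
      have e2 := R.adj₄.unit.naturality g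
      simp only [Functor.id_map, Functor.comp_map] at e1 e2
      exact e1.trans (by rw [h2]; exact e2.symm)
  ess A C := by
    have := R.jUS_lims
    have := R.jUS_colims
    have := R.iUS.additive_of_preserves_binary_products
    have := R.jUS.additive_of_preserves_binary_products
    have a := isIso_map_fst R.iUS (R.iStar.obj A) (R.jLS.obj C) (R.iUS_jLS _)
    have b := isIso_map_snd R.jUS (R.iStar.obj A) (R.jLS.obj C) (R.jUS_iStar _)
    exact ⟨R.iStar.obj A ⊞ R.jLS.obj C, ⟨asIso (R.iUS.map biprod.fst) ≪≫ R.isoA A⟩,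
      ⟨asIso (R.jUS.map biprod.snd) ≪≫ R.isoC C⟩⟩

/-- `i^! = i^*` on objects -/
theorem iUE_iso (B : ℬ) : Nonempty (R.iUS.obj B ≅ R.iUE.obj B) := by
  have := R.isIso_dec B
  have := R.iUE.additive_of_preserves_binary_products
  have a := isIso_map_fst R.iUE (R.iStar.obj (R.iUS.obj B)) (R.jLS.obj (R.jUS.obj B))
    (R.iUE_jLS _)
  exact ⟨(R.iUE.mapIso (asIso (R.dec B)) ≪≫ asIso (R.iUE.map biprod.fst) ≪≫ R.isoA' _).symm⟩

end Recollement

end Recoll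

/-- If `𝒵'` and `𝒵''` are support τ-tilting subcategories of `𝒜` and `𝒞`, and
`i^*`, `i^!` are exact, then `𝒵 = {Z ∈ ℬ | i^*(Z) ∈ 𝒵', i^!(Z) ∈ 𝒵', j^*(Z) ∈ 𝒵''}` is a
support τ-tilting subcategory of `ℬ`. -/
theorem stmt_6
    {𝒜 : Type u₁} {ℬ : Type u₂} {𝒞 : Type u₃}
    [Category.{v₁} 𝒜] [Category.{v₂} ℬ] [Category.{v₃} 𝒞]
    [Abelian 𝒜] [Abelian ℬ] [Abelian 𝒞]
    [EnoughProjectives 𝒜] [EnoughInjectives 𝒜]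
    [EnoughProjectives ℬ] [EnoughInjectives ℬ]
    [EnoughProjectives 𝒞] [EnoughInjectives 𝒞]
    [HasExt.{w₁} 𝒜] [HasExt.{w₂} ℬ] [HasExt.{w₃} 𝒞]
    (R : Recollement 𝒜 ℬ 𝒞)
    (𝒵' : Set 𝒜) (𝒵'' : Set 𝒞)
    (good' : IsGoodSubcat 𝒵') (good'' : IsGoodSubcat 𝒵'')
    (h' : SupportTauTilting 𝒵') (h'' : SupportTauTilting 𝒵'')
    [PreservesFiniteLimits R.iUS] [PreservesFiniteColimits R.iUS]
    [PreservesFiniteLimits R.iUE] [PreservesFiniteColimits R.iUE] :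
    SupportTauTilting
      {Z : ℬ | R.iUS.obj Z ∈ 𝒵' ∧ R.iUE.obj Z ∈ 𝒵' ∧ R.jUS.obj Z ∈ 𝒵''} := by
  have := R.jUS_lims
  have := R.jUS_colims
  have key := R.prodLike.supportTauTilting (𝒵' := 𝒵') (𝒵'' := 𝒵'') good' good'' h' h''
  convert key using 1
  ext Z
  refine ⟨fun h => ⟨h.1, h.2.2⟩, fun h => ⟨h.1, ?_, h.2⟩⟩
  exact good'.1 (R.iUE_iso Z).some h.1
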